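/- arXiv:2305.05319 — 7 statements merged into one kernel-verified Lean document; each statement's English description precedes it below -/
import Mathlib

section
/- Let α > 0, T > 0, and let f : ℝ×ℝ → ℝ be infinitely differentiable. Let F(t,u) = ∫₀^u (∫₀^v f(t,w) dw) dv − u ∫₀^1 (∫₀^v f(t,w) dw) dv be the Dirichlet solution. For each integer N ≥ 2, let F^N : [0,T]×{0, 1/N, …, 1} → ℝ be such that t ↦ F^N(t, x/N) is C¹ for each x, F^N satisfies N^{−α} ∂_t F^N(t, x/N) + N²(F^N(t,(x+1)/N) + F^N(t,(x−1)/N) − 2F^N(t,x/N)) = f(t, x/N) for all x ∈ {1,…,N−1} and t ∈ (0,T), F^N(t,0) = F^N(t,1) = 0 for all t ∈ [0,T], and F^N(T, x/N) = F(T, x/N) for all x. Then lim_{N→∞} N^{−α} · N^{−1} Σ_{z=1}^{N−1} |F^N(0, z/N)|² = 0. -/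
open Set intervalIntegral Filter

/-- A differentiable function whose maximum over `[a, b]` is attained at `t < b` has a nonpositive
one-sided derivative there. -/
theorem HasDerivWithinAt.nonpos_of_isMaxOn_Icc {a b t d : ℝ} {g : ℝ → ℝ} (ht : t ∈ Ico a b)
    (hd : HasDerivWithinAt g d (Icc a b) t) (hmax : IsMaxOn g (Icc a b) t) : d ≤ 0 := by
  have hright : HasDerivWithinAt g d (Ioc t b) t :=
    hd.mono fun s hs => ⟨ht.1.trans hs.1.le, hs.2⟩
  rw [hasDerivWithinAt_iff_tendsto_slope' (by simp)] at hright
  have : (nhdsWithin t (Ioc t b)).NeBot := by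
    rw [nhdsWithin_Ioc_eq_nhdsGT ht.2]
    infer_instance
  refine le_of_tendsto hright ?_
  filter_upwards [self_mem_nhdsWithin] with s hs
  have hle : g s ≤ g t := hmax ⟨ht.1.trans hs.1.le, hs.2⟩
  rw [slope_def_field]
  exact div_nonpos_of_nonpos_of_nonneg (sub_nonpos.2 hle) (sub_nonneg.2 hs.1.le)

/-- Maximum principle for strict subsolutions of a backward parabolic equation on the lattice
segment `{0, …, N}`. -/
theorem discrete_backward_maximum_principle {N : ℕ} {T a b : ℝ} (ha : 0 < a) (hb : 0 ≤ b)
    {w w' : ℝ → ℕ → ℝ}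
    (hderiv : ∀ x ≤ N, ∀ t ∈ Icc 0 T, HasDerivWithinAt (fun s => w s x) (w' t x) (Icc 0 T) t)
    (hsub : ∀ x, 1 ≤ x → x ≤ N - 1 → ∀ t ∈ Ico 0 T,
      0 < a * w' t x + b * (w t (x + 1) + w t (x - 1) - 2 * w t x))
    (hbdry : ∀ t ∈ Icc 0 T, w t 0 ≤ 0 ∧ w t N ≤ 0)
    (hterm : ∀ x ≤ N, w T x ≤ 0) :
    ∀ t ∈ Icc 0 T, ∀ x ≤ N, w t x ≤ 0 := by
  intro t ht x hx
  have hne : (Icc 0 T).Nonempty := ⟨t, ht⟩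
  have hmax : ∀ y ≤ N, ∃ s ∈ Icc 0 T, IsMaxOn (fun s => w s y) (Icc 0 T) s := fun y hy =>
    isCompact_Icc.exists_isMaxOn hne fun s hs => (hderiv y hy s hs).continuousWithinAt
  choose! τ hτ hτmax using hmax
  obtain ⟨y, hy, hymax⟩ := (Finset.range (N + 1)).exists_max_image (fun y => w (τ y) y)
    ⟨0, by simp⟩
  have hyN : y ≤ N := by simpa [Nat.lt_succ_iff] using hy
  have hglobal : ∀ s ∈ Icc 0 T, ∀ z ≤ N, w s z ≤ w (τ y) y := fun s hs z hz =>
    (hτmax z hz hs).trans (hymax z (by simpa [Nat.lt_succ_iff] using hz))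
  refine (hglobal t ht x hx).trans ?_
  have hτy := hτ y hyN
  rcases hτy.2.eq_or_lt with hlast | hlt
  · rw [hlast]
    exact hterm y hyN
  rcases Nat.eq_zero_or_pos y with hy0 | hy0
  · have h := (hbdry _ hτy).1
    rwa [← hy0] at h
  rcases hyN.eq_or_lt with hyN' | hyN'
  · have h := (hbdry _ hτy).2
    rwa [← hyN'] at h
  have hd : w' (τ y) y ≤ 0 :=
    (hderiv y hyN _ hτy).nonpos_of_isMaxOn_Icc ⟨hτy.1, hlt⟩ (hτmax y hyN)
  have hlap : w (τ y) (y + 1) + w (τ y) (y - 1) - 2 * w (τ y) y ≤ 0 := by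
    linarith [hglobal _ hτy (y + 1) hyN', hglobal _ hτy (y - 1) (by omega)]
  have h := hsub y hy0 (by omega) _ ⟨hτy.1, hlt⟩
  linarith [mul_nonpos_of_nonneg_of_nonpos ha.le hd, mul_nonpos_of_nonneg_of_nonpos hb hlap]

/-- Uniform bound for solutions of the discrete backward heat equation with Dirichlet boundary
conditions, by comparison with the parabola `x ↦ x (N - x)`. -/
theorem le_of_discrete_backward_heat {N : ℕ} (hN : 2 ≤ N) {T a C M : ℝ} (ha : 0 < a)
    (hC : 0 ≤ C) (hM : 0 ≤ M) {v v' r : ℝ → ℕ → ℝ}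
    (hderiv : ∀ x ≤ N, ∀ t ∈ Icc 0 T, HasDerivWithinAt (fun s => v s x) (v' t x) (Icc 0 T) t)
    (heq : ∀ x, 1 ≤ x → x ≤ N - 1 → ∀ t ∈ Ico 0 T,
      a * v' t x + (N : ℝ) ^ 2 * (v t (x + 1) + v t (x - 1) - 2 * v t x) = r t x)
    (hr : ∀ x, 1 ≤ x → x ≤ N - 1 → ∀ t ∈ Ico 0 T, -M ≤ r t x)
    (hbdry : ∀ t ∈ Icc 0 T, v t 0 = 0 ∧ v t N = 0)
    (hterm : ∀ x ≤ N, v T x ≤ C) :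
    ∀ t ∈ Icc 0 T, ∀ x ≤ N, v t x ≤ C + (M + 1) := by
  have hN0 : (0 : ℝ) < N := by exact_mod_cast (by omega : 0 < N)
  set p : ℕ → ℝ := fun x => (M + 1) / (2 * (N : ℝ) ^ 2) * (x * (N - x)) with hp
  have hp0 : ∀ x ≤ N, 0 ≤ p x := fun x hx => by
    have : (x : ℝ) ≤ N := by exact_mod_cast hx
    exact mul_nonneg (by positivity) (mul_nonneg (by positivity) (by linarith))
  have hp1 : ∀ x ≤ N, p x ≤ M + 1 := fun x hx => by
    have : (x : ℝ) ≤ N := by exact_mod_cast hx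
    rw [hp]
    dsimp only
    rw [div_mul_eq_mul_div, div_le_iff₀ (by positivity)]
    refine mul_le_mul_of_nonneg_left ?_ (by linarith)
    nlinarith [sq_nonneg ((x : ℝ) - N), sq_nonneg (x : ℝ)]
  have key := discrete_backward_maximum_principle (N := N) (T := T) (a := a) (b := (N : ℝ) ^ 2)
    (w := fun t x => v t x - (C + p x)) (w' := v') ha (by positivity)
    (fun x hx t ht => (hderiv x hx t ht).sub_const _) ?_ ?_ ?_
  · intro t ht x hx
    linarith [key t ht x hx, hp1 x hx]
  · intro x hx1 hxN t ht
    have hlap : (N : ℝ) ^ 2 * (p (x + 1) + p (x - 1) - 2 * p x) = -(M + 1) := by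
      simp only [hp]
      push_cast [Nat.cast_sub hx1]
      field_simp
      ring
    linarith [heq x hx1 hxN t ht, hr x hx1 hxN t ht]
  · intro t ht
    have h := hbdry t ht
    exact ⟨by linarith [hp0 0 (by omega)], by linarith [hp0 N le_rfl]⟩
  · intro x hx
    linarith [hterm x hx, hp0 x hx]

/-- Lemma 3.2, first conclusion (equation (3.15)): if `F^N` solves the discrete
backward equation `N^{−α} ∂_t F^N + Δ̃_N F^N = f` on `{1,…,N−1}` with Dirichlet
boundary conditions and terminal condition `F^N(T,·) = F(T,·)`, where `F(t,·)`
is the explicit Dirichlet solution of `∂_u²F(t,·) = f(t,·)`, then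
`N^{−α} · N^{−1} Σ_{z=1}^{N−1} |F^N(0,z/N)|² → 0` as `N → ∞`. -/
theorem discrete_approximation_initial_bound
    (α T : ℝ) (hα : 0 < α) (hT : 0 < T)
    (f : ℝ → ℝ → ℝ) (hf : ContDiff ℝ (⊤ : ℕ∞) (fun q : ℝ × ℝ => f q.1 q.2))
    (F : ℝ → ℝ → ℝ)
    (hF : ∀ t u : ℝ, F t u =
        (∫ v in (0:ℝ)..u, ∫ w in (0:ℝ)..v, f t w)
          - u * ∫ v in (0:ℝ)..(1:ℝ), ∫ w in (0:ℝ)..v, f t w)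
    (FN FN' : ℕ → ℝ → ℕ → ℝ)
    (hC1 : ∀ N : ℕ, 2 ≤ N → ∀ x ≤ N,
        ContinuousOn (fun t => FN' N t x) (Icc 0 T) ∧
        ∀ t ∈ Icc (0:ℝ) T,
          HasDerivWithinAt (fun s => FN N s x) (FN' N t x) (Icc 0 T) t)
    (hEq : ∀ N : ℕ, 2 ≤ N → ∀ x : ℕ, 1 ≤ x → x ≤ N - 1 → ∀ t ∈ Ioo (0:ℝ) T,
        (N : ℝ) ^ (-α) * FN' N t x
          + (N : ℝ) ^ 2 * (FN N t (x + 1) + FN N t (x - 1) - 2 * FN N t x)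
          = f t ((x : ℝ) / N))
    (hBdry : ∀ N : ℕ, 2 ≤ N → ∀ t ∈ Icc (0:ℝ) T, FN N t 0 = 0 ∧ FN N t N = 0)
    (hTerm : ∀ N : ℕ, 2 ≤ N → ∀ x ≤ N, FN N T x = F T ((x : ℝ) / N)) :
    Tendsto
      (fun N : ℕ => (N : ℝ) ^ (-α) * (N : ℝ)⁻¹ *
          ∑ z ∈ Finset.Icc 1 (N - 1), (FN N 0 z) ^ 2)
      atTop (nhds 0) := by
  have hfc : Continuous fun q : ℝ × ℝ => f q.1 q.2 := hf.continuous
  obtain ⟨M, hM⟩ := (isCompact_Icc.prod isCompact_Icc).exists_bound_of_continuousOn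
    (s := Icc (0 : ℝ) T ×ˢ Icc (0 : ℝ) 1) hfc.continuousOn
  have hFc : Continuous (F T) := by
    have hfT : Continuous (f T) := hfc.comp (Continuous.prodMk_right T)
    have h₁ : Continuous fun v => ∫ w in (0 : ℝ)..v, f T w :=
      continuous_primitive (fun _ _ => hfT.intervalIntegrable _ _) 0
    have h₂ : Continuous fun u => ∫ v in (0 : ℝ)..u, ∫ w in (0 : ℝ)..v, f T w :=
      continuous_primitive (fun _ _ => h₁.intervalIntegrable _ _) 0
    rw [funext (hF T)]
    exact h₂.sub (continuous_id.mul continuous_const)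
  obtain ⟨C, hC⟩ := isCompact_Icc.exists_bound_of_continuousOn (s := Icc (0 : ℝ) 1)
    hFc.continuousOn
  have hM0 : 0 ≤ M := (norm_nonneg _).trans (hM (0, 0) (by simp [hT.le]))
  have hC0 : 0 ≤ C := (norm_nonneg _).trans (hC 0 (by simp))
  have hbound : ∀ N : ℕ, 2 ≤ N → ∀ x ≤ N, |FN N 0 x| ≤ C + (M + 1) := by
    intro N hN
    have hN0 : (0 : ℝ) < N := by exact_mod_cast (by omega : 0 < N)
    have ha : 0 < (N : ℝ) ^ (-α) := Real.rpow_pos_of_pos hN0 _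
    have hmem : ∀ x ≤ N, (x : ℝ) / N ∈ Icc (0 : ℝ) 1 := fun x hx =>
      ⟨by positivity, (div_le_one hN0).2 (by exact_mod_cast hx)⟩
    have hcont : ∀ x ≤ N, ContinuousOn (fun t => FN N t x) (Icc 0 T) := fun x hx t ht =>
      ((hC1 N hN x hx).2 t ht).continuousWithinAt
    have heq : ∀ x : ℕ, 1 ≤ x → x ≤ N - 1 → ∀ t ∈ Icc (0:ℝ) T,
        (N : ℝ) ^ (-α) * FN' N t x
          + (N : ℝ) ^ 2 * (FN N t (x + 1) + FN N t (x - 1) - 2 * FN N t x)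
          = f t ((x : ℝ) / N) := by
      intro x hx1 hxN
      refine EqOn.of_subset_closure (s := Ioo 0 T) (hEq N hN x hx1 hxN) ?_ ?_ Ioo_subset_Icc_self
        (closure_Ioo hT.ne).symm.subset
      · have h' := (hC1 N hN x (by omega)).1
        have h₀ := hcont x (by omega)
        have h₁ := hcont (x + 1) (by omega)
        have h₂ := hcont (x - 1) (by omega)
        exact (continuousOn_const.mul h').add
          (continuousOn_const.mul ((h₁.add h₂).sub (continuousOn_const.mul h₀)))
      · exact (hfc.comp (Continuous.prodMk_left ((x : ℝ) / N))).continuousOn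
    have hfM : ∀ x : ℕ, x ≤ N - 1 → ∀ t ∈ Ico (0 : ℝ) T, |f t ((x : ℝ) / N)| ≤ M :=
      fun x hx t ht => hM (t, (x : ℝ) / N) ⟨Ico_subset_Icc_self ht, hmem x (by omega)⟩
    have hFC : ∀ x ≤ N, |FN N T x| ≤ C := fun x hx => by
      rw [hTerm N hN x hx]
      exact hC _ (hmem x hx)
    intro x hx
    refine abs_le'.2 ⟨?_, ?_⟩
    · exact le_of_discrete_backward_heat hN ha hC0 hM0 (fun x hx => (hC1 N hN x hx).2)
        (fun x hx1 hxN t ht => heq x hx1 hxN t (Ico_subset_Icc_self ht))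
        (fun x _ hxN t ht => (abs_le.1 (hfM x hxN t ht)).1) (hBdry N hN)
        (fun x hx => (abs_le.1 (hFC x hx)).2) 0 ⟨le_rfl, hT.le⟩ x hx
    · exact le_of_discrete_backward_heat (v := fun t x => -FN N t x)
        (v' := fun t x => -FN' N t x) (r := fun t x => -f t ((x : ℝ) / N)) hN ha hC0 hM0
        (fun x hx t ht => ((hC1 N hN x hx).2 t ht).neg)
        (fun x hx1 hxN t ht => by linarith [heq x hx1 hxN t (Ico_subset_Icc_self ht)])
        (fun x _ hxN t ht => neg_le_neg (abs_le.1 (hfM x hxN t ht)).2)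
        (fun t ht => by simpa using hBdry N hN t ht)
        (fun x hx => neg_le.1 (abs_le.1 (hFC x hx)).1) 0 ⟨le_rfl, hT.le⟩ x hx
  have hlim : Tendsto (fun N : ℕ => (N : ℝ) ^ (-α) * (C + (M + 1)) ^ 2) atTop (nhds 0) := by
    simpa using ((tendsto_rpow_neg_atTop hα).comp tendsto_natCast_atTop_atTop).mul_const
      ((C + (M + 1)) ^ 2)
  refine squeeze_zero' (Eventually.of_forall fun N => by positivity) ?_ hlim
  filter_upwards [eventually_ge_atTop 2] with N hN
  have hN0 : (0 : ℝ) < N := by exact_mod_cast (by omega : 0 < N)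
  rw [mul_assoc]
  refine mul_le_mul_of_nonneg_left ?_ (by positivity)
  rw [inv_mul_le_iff₀ hN0]
  calc ∑ z ∈ Finset.Icc 1 (N - 1), FN N 0 z ^ 2
      ≤ ∑ _z ∈ Finset.Icc 1 (N - 1), (C + (M + 1)) ^ 2 := by
        refine Finset.sum_le_sum fun z hz => ?_
        rw [Finset.mem_Icc] at hz
        exact sq_le_sq.2 ((hbound N hN z (by omega)).trans (le_abs_self _))
    _ = ((N - 1 : ℕ) : ℝ) * (C + (M + 1)) ^ 2 := by simp
    _ ≤ N * (C + (M + 1)) ^ 2 := by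
        gcongr
        omega
end

section
/- Let α > 0, T > 0, and let f : ℝ×ℝ → ℝ be infinitely differentiable. Let F(t,u) = ∫₀^u (∫₀^v f(t,w) dw) dv − u ∫₀^1 (∫₀^v f(t,w) dw) dv be the Dirichlet solution. For each integer N ≥ 2, let F^N : [0,T]×{0, 1/N, …, 1} → ℝ be such that t ↦ F^N(t, x/N) is C¹ for each x, F^N satisfies N^{−α} ∂_t F^N(t, x/N) + N²(F^N(t,(x+1)/N) + F^N(t,(x−1)/N) − 2F^N(t,x/N)) = f(t, x/N) for all x ∈ {1,…,N−1} and t ∈ (0,T), F^N(t,0) = F^N(t,1) = 0 for all t ∈ [0,T], and F^N(T, x/N) = F(T, x/N) for all x. Then lim_{N→∞} ∫₀^T N^{−1} Σ_{z=0}^{N−1} | N( F^N(t,(z+1)/N) − F^N(t,z/N) ) − ∂_uF(t, z/N) |² dt = 0. -/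
open Set intervalIntegral Filter

/-- Discrete summation by parts. -/
theorem sum_mul_secondDifference (e : ℕ → ℝ) (n : ℕ) :
    ∑ x ∈ Finset.range n, e x * (e (x + 1) + e (x - 1) - 2 * e x) =
      e n * (e n - e (n - 1)) - ∑ z ∈ Finset.range n, (e (z + 1) - e z) ^ 2 := by
  induction n with
  | zero => simp
  | succ n ih =>
    rw [Finset.sum_range_succ, Finset.sum_range_succ, ih, Nat.add_sub_cancel]
    ring

/-- Discrete Poincaré inequality in the supremum norm. -/
theorem sq_le_mul_sum_sq_difference (e : ℕ → ℝ) (h0 : e 0 = 0) {x N : ℕ} (hx : x ≤ N) :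
    e x ^ 2 ≤ N * ∑ z ∈ Finset.range N, (e (z + 1) - e z) ^ 2 := by
  have hsum : e x = ∑ z ∈ Finset.range x, (e (z + 1) - e z) := by
    rw [Finset.sum_range_sub, h0, sub_zero]
  calc e x ^ 2 ≤ x * ∑ z ∈ Finset.range x, (e (z + 1) - e z) ^ 2 := by
        rw [hsum]
        simpa using sq_sum_le_card_mul_sum_sq (s := Finset.range x) (f := fun z => e (z + 1) - e z)
    _ ≤ _ := by
        gcongr

/-- Pointwise-in-time energy estimate for the discrete Dirichlet problem. -/
theorem discrete_energy_estimate (e e' r : ℕ → ℝ) {N : ℕ} (hN : 0 < N) {a ε : ℝ}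
    (h0 : e 0 = 0) (hend : e N = 0)
    (heq : ∀ x, 1 ≤ x → x ≤ N - 1 →
      a * e' x + (N : ℝ) ^ 2 * (e (x + 1) + e (x - 1) - 2 * e x) = r x)
    (hr : ∀ x, 1 ≤ x → x ≤ N - 1 → |r x| ≤ ε) :
    N * ∑ z ∈ Finset.range N, (e (z + 1) - e z) ^ 2 ≤
      a / N * ∑ x ∈ Finset.range N, 2 * e x * e' x + ε ^ 2 := by
  have hN' : (0 : ℝ) < N := by exact_mod_cast hN
  set S := ∑ z ∈ Finset.range N, (e (z + 1) - e z) ^ 2 with hS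
  have hparts := sum_mul_secondDifference e N
  rw [hend, zero_mul, zero_sub, ← hS] at hparts
  have hterm : ∀ x ∈ Finset.range N,
      -(N * S + ε ^ 2) ≤ a * (2 * e x * e' x)
        + 2 * (N : ℝ) ^ 2 * (e x * (e (x + 1) + e (x - 1) - 2 * e x)) := by
    intro x hx
    have hxN := Finset.mem_range.1 hx
    have hP : e x ^ 2 ≤ N * S := sq_le_mul_sum_sq_difference e h0 hxN.le
    rcases Nat.eq_zero_or_pos x with rfl | hx0
    · simp only [h0] at hP ⊢
      nlinarith [sq_nonneg ε]
    · have h1 := heq x hx0 (by omega)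
      have h2 : r x ^ 2 ≤ ε ^ 2 := sq_le_sq' (abs_le.1 (hr x hx0 (by omega))).1
        (abs_le.1 (hr x hx0 (by omega))).2
      have h3 : a * (2 * e x * e' x)
        + 2 * (N : ℝ) ^ 2 * (e x * (e (x + 1) + e (x - 1) - 2 * e x)) = 2 * e x * r x := by
        rw [← h1]; ring
      rw [h3]
      nlinarith [sq_nonneg (e x + r x)]
  have hsum := Finset.sum_le_sum hterm
  rw [Finset.sum_add_distrib, ← Finset.mul_sum, ← Finset.mul_sum, hparts, Finset.sum_const,
    Finset.card_range, nsmul_eq_mul] at hsum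
  rw [div_mul_eq_mul_div, ← sub_le_iff_le_add, le_div_iff₀ hN']
  nlinarith

section Dirichlet

variable {g : ℝ → ℝ} {c : ℝ} {P : ℝ → ℝ}

theorem sub_eq_integral_primitive (hg : Continuous g)
    (hP : ∀ u, P u = (∫ v in (0:ℝ)..u, ∫ w in (0:ℝ)..v, g w) - u * c) (u v : ℝ) :
    P v - P u = (∫ s in u..v, ∫ w in (0:ℝ)..s, g w) - (v - u) * c := by
  have hΦ : Continuous fun v => ∫ w in (0:ℝ)..v, g w :=
    continuous_primitive (fun a b => hg.intervalIntegrable a b) 0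
  rw [hP, hP, ← integral_interval_sub_left (hΦ.intervalIntegrable 0 v) (hΦ.intervalIntegrable 0 u)]
  ring

theorem abs_difference_sub_le (hg : Continuous g)
    (hP : ∀ u, P u = (∫ v in (0:ℝ)..u, ∫ w in (0:ℝ)..v, g w) - u * c) {z h M : ℝ} (hh : 0 ≤ h)
    (hM : ∀ w ∈ Icc z (z + h), |g w| ≤ M) :
    |P (z + h) - P z - h * ((∫ w in (0:ℝ)..z, g w) - c)| ≤ M * h ^ 2 := by
  have hΦ : Continuous fun v => ∫ w in (0:ℝ)..v, g w :=
    continuous_primitive (fun a b => hg.intervalIntegrable a b) 0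
  have hM0 : 0 ≤ M := (abs_nonneg _).trans (hM z ⟨le_rfl, by linarith⟩)
  have hrepr : P (z + h) - P z - h * ((∫ w in (0:ℝ)..z, g w) - c)
      = ∫ s in z..(z + h), ∫ w in z..s, g w := by
    have h1 : ∀ s, ∫ w in z..s, g w = (∫ w in (0:ℝ)..s, g w) - ∫ w in (0:ℝ)..z, g w := fun s =>
      (integral_interval_sub_left (hg.intervalIntegrable 0 s) (hg.intervalIntegrable 0 z)).symm
    simp_rw [h1]
    rw [sub_eq_integral_primitive hg hP, integral_sub (hΦ.intervalIntegrable _ _) (by simp),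
      integral_const, smul_eq_mul]
    ring
  rw [hrepr]
  have hb := norm_integral_le_of_norm_le_const (a := z) (b := z + h) (C := M * h)
    (f := fun s => ∫ w in z..s, g w) fun s hs => by
      rw [uIoc_of_le (by linarith)] at hs
      refine (norm_integral_le_of_norm_le_const (C := M) fun w hw => ?_).trans ?_
      · rw [uIoc_of_le hs.1.le] at hw
        exact hM w ⟨hw.1.le, hw.2.trans hs.2⟩
      · rw [abs_of_nonneg (by linarith [hs.1])]
        gcongr
        linarith [hs.2]
  rw [Real.norm_eq_abs, add_sub_cancel_left, abs_of_nonneg hh] at hb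
  linarith

theorem abs_secondDifference_sub_le (hg : Continuous g)
    (hP : ∀ u, P u = (∫ v in (0:ℝ)..u, ∫ w in (0:ℝ)..v, g w) - u * c) {x h η : ℝ} (hh : 0 ≤ h)
    (hη : ∀ w ∈ Icc (x - h) (x + h), |g w - g x| ≤ η) :
    |P (x + h) + P (x - h) - 2 * P x - h ^ 2 * g x| ≤ η * h ^ 2 := by
  have hΦ : Continuous fun v => ∫ w in (0:ℝ)..v, g w :=
    continuous_primitive (fun a b => hg.intervalIntegrable a b) 0
  have hrepr : P (x + h) + P (x - h) - 2 * P x - h ^ 2 * g x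
      = ∫ s in x..(x + h), ∫ w in (s - h)..s, (g w - g x) := by
    have h1 : ∀ s, ∫ w in (s - h)..s, (g w - g x)
        = (∫ w in (0:ℝ)..s, g w) - (∫ w in (0:ℝ)..(s - h), g w) - h * g x := fun s => by
      rw [integral_sub (hg.intervalIntegrable _ _) (by simp), integral_const, smul_eq_mul,
        integral_interval_sub_left (hg.intervalIntegrable _ _) (hg.intervalIntegrable _ _)]
      ring
    have hΦh : Continuous fun v => ∫ w in (0:ℝ)..(v - h), g w := hΦ.comp (continuous_sub_right h)
    simp_rw [h1]
    rw [integral_sub ((hΦ.fun_sub hΦh).intervalIntegrable _ _) (by simp),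
      integral_sub (hΦ.intervalIntegrable _ _) (hΦh.intervalIntegrable _ _),
      integral_comp_sub_right (fun v => ∫ w in (0:ℝ)..v, g w), integral_const, smul_eq_mul,
      add_sub_cancel_right]
    have h2 := sub_eq_integral_primitive hg hP x (x + h)
    have h3 := sub_eq_integral_primitive hg hP (x - h) x
    linear_combination h2 - h3
  rw [hrepr]
  have hb := norm_integral_le_of_norm_le_const (a := x) (b := x + h) (C := η * h)
    (f := fun s => ∫ w in (s - h)..s, (g w - g x)) fun s hs => by
      rw [uIoc_of_le (by linarith)] at hs
      refine (norm_integral_le_of_norm_le_const (C := η) fun w hw => ?_).trans ?_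
      · rw [uIoc_of_le (by linarith)] at hw
        exact hη w ⟨by linarith [hw.1, hs.1], hw.2.trans hs.2⟩
      · rw [sub_sub_cancel, abs_of_nonneg hh]
  rw [Real.norm_eq_abs, add_sub_cancel_left, abs_of_nonneg hh] at hb
  linarith

theorem hasDerivAt_dirichlet (hg : Continuous g)
    (hP : ∀ u, P u = (∫ v in (0:ℝ)..u, ∫ w in (0:ℝ)..v, g w) - u * c) (u : ℝ) :
    HasDerivAt P ((∫ w in (0:ℝ)..u, g w) - c) u := by
  have hΦ : Continuous fun v => ∫ w in (0:ℝ)..v, g w :=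
    continuous_primitive (fun a b => hg.intervalIntegrable a b) 0
  rw [funext hP]
  simpa using (hΦ.integral_hasStrictDerivAt 0 u).hasDerivAt.fun_sub
    ((hasDerivAt_id u).mul_const c)

end Dirichlet

/-- Differentiation under the integral sign with jointly continuous derivative. -/
theorem hasDerivAt_integral_of_continuous {g g' : ℝ → ℝ → ℝ}
    (hg : Continuous (Function.uncurry g)) (hg' : Continuous (Function.uncurry g'))
    (hd : ∀ t w, HasDerivAt (fun s => g s w) (g' t w) t) (a b t : ℝ) :
    HasDerivAt (fun s => ∫ w in a..b, g s w) (∫ w in a..b, g' t w) t := by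
  obtain ⟨M, hM⟩ := ((isCompact_Icc (a := t - 1) (b := t + 1)).prod
    (isCompact_uIcc (a := a) (b := b))).exists_bound_of_continuousOn hg'.continuousOn
  have hslice : ∀ s, Continuous (g s) := fun s => hg.comp (Continuous.prodMk_right s)
  refine (hasDerivAt_integral_of_dominated_loc_of_deriv_le (F' := g') (bound := fun _ => M)
    (Icc_mem_nhds (by linarith : t - 1 < t) (by linarith : t < t + 1))
    (Eventually.of_forall fun s => (hslice s).aestronglyMeasurable)
    ((hslice t).intervalIntegrable a b)
    (hg'.comp (Continuous.prodMk_right t)).aestronglyMeasurable ?_ (by simp) ?_).2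
  · exact Eventually.of_forall fun w hw s hs => hM (s, w) ⟨hs, uIoc_subset_uIcc hw⟩
  · exact Eventually.of_forall fun w _ s _ => hd s w

theorem exists_hasDerivAt_dirichlet_time {f F : ℝ → ℝ → ℝ}
    (hf : ContDiff ℝ 1 (fun q : ℝ × ℝ => f q.1 q.2))
    (hF : ∀ t u : ℝ, F t u =
        (∫ v in (0:ℝ)..u, ∫ w in (0:ℝ)..v, f t w)
          - u * ∫ v in (0:ℝ)..(1:ℝ), ∫ w in (0:ℝ)..v, f t w) :
    ∃ Ft : ℝ → ℝ → ℝ, Continuous (Function.uncurry Ft) ∧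
      ∀ t u, HasDerivAt (fun s => F s u) (Ft t u) t := by
  let f' : ℝ → ℝ → ℝ := fun t w => fderiv ℝ (fun q : ℝ × ℝ => f q.1 q.2) (t, w) (1, 0)
  have hfc : Continuous (Function.uncurry f) := hf.continuous
  have hf'c : Continuous (Function.uncurry f') :=
    (hf.continuous_fderiv one_ne_zero).clm_apply continuous_const
  have hfd : ∀ t w, HasDerivAt (fun s => f s w) (f' t w) t := fun t w =>
    (hf.differentiable one_ne_zero (t, w)).hasFDerivAt.comp_hasDerivAt (f := fun s => (s, w)) t
      ((hasDerivAt_id t).prodMk (hasDerivAt_const t w))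
  have hprim : ∀ {g : ℝ → ℝ → ℝ}, Continuous (Function.uncurry g) →
      Continuous (Function.uncurry fun t v => ∫ w in (0:ℝ)..v, g t w) := fun hg =>
    continuous_parametric_primitive_of_continuous hg
  have hd1 : ∀ t v, HasDerivAt (fun s => ∫ w in (0:ℝ)..v, f s w) (∫ w in (0:ℝ)..v, f' t w) t :=
    fun t v => hasDerivAt_integral_of_continuous hfc hf'c hfd 0 v t
  have hd2 : ∀ t u, HasDerivAt (fun s => ∫ v in (0:ℝ)..u, ∫ w in (0:ℝ)..v, f s w)
      (∫ v in (0:ℝ)..u, ∫ w in (0:ℝ)..v, f' t w) t := fun t u =>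
    hasDerivAt_integral_of_continuous (hprim hfc) (hprim hf'c) hd1 0 u t
  refine ⟨fun t u => (∫ v in (0:ℝ)..u, ∫ w in (0:ℝ)..v, f' t w)
    - u * ∫ v in (0:ℝ)..(1:ℝ), ∫ w in (0:ℝ)..v, f' t w, ?_, fun t u => ?_⟩
  · have h2 := hprim (hprim hf'c)
    exact h2.sub (continuous_snd.mul (h2.comp (continuous_fst.prodMk continuous_const)))
  · simp_rw [hF]
    exact (hd2 t u).sub ((hd2 t 1).const_mul u)

/-- Space-time energy estimate for a discrete parabolic problem with vanishing Dirichlet and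
terminal data, with a perturbation `D` of the discrete gradient. -/
theorem integral_sq_gradient_le {N : ℕ} (hN : 0 < N) {a T ε δ : ℝ} (ha : 0 ≤ a) (hT : 0 ≤ T)
    {e e' D : ℝ → ℕ → ℝ}
    (hder : ∀ x ≤ N, ∀ t ∈ Icc (0:ℝ) T,
      HasDerivWithinAt (fun s => e s x) (e' t x) (Icc 0 T) t)
    (hres : ∀ x, 1 ≤ x → x ≤ N - 1 → ∀ t ∈ Ioo (0:ℝ) T,
      |a * e' t x + (N : ℝ) ^ 2 * (e t (x + 1) + e t (x - 1) - 2 * e t x)| ≤ ε)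
    (hbdry : ∀ t ∈ Icc (0:ℝ) T, e t 0 = 0 ∧ e t N = 0)
    (hterm : ∀ x ≤ N, e T x = 0)
    (hDc : ∀ z < N, ContinuousOn (fun t => D t z) (Icc 0 T))
    (hD : ∀ z < N, ∀ t ∈ Icc (0:ℝ) T, |D t z| ≤ δ) :
    ∫ t in (0:ℝ)..T, (N : ℝ)⁻¹ * ∑ z ∈ Finset.range N,
      ((N : ℝ) * (e t (z + 1) - e t z) + D t z) ^ 2 ≤ (2 * ε ^ 2 + 2 * δ ^ 2) * T := by
  have hN' : (0 : ℝ) < N := by exact_mod_cast hN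
  have hec : ∀ x ≤ N, ContinuousOn (fun t => e t x) (Icc 0 T) := fun x hx t ht =>
    (hder x hx t ht).continuousWithinAt
  let g : ℝ → ℝ := fun t =>
    2 * (a / N * ∑ x ∈ Finset.range N, e t x ^ 2) + (2 * ε ^ 2 + 2 * δ ^ 2) * t
  let g' : ℝ → ℝ := fun t =>
    2 * (a / N * ∑ x ∈ Finset.range N, 2 * e t x * e' t x) + (2 * ε ^ 2 + 2 * δ ^ 2)
  have hgd : ∀ t ∈ Icc 0 T, HasDerivWithinAt g (g' t) (Icc 0 T) t := by
    intro t ht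
    have hsum : HasDerivWithinAt (fun t => ∑ x ∈ Finset.range N, e t x ^ 2)
        (∑ x ∈ Finset.range N, 2 * e t x * e' t x) (Icc 0 T) t := by
      refine HasDerivWithinAt.fun_sum fun x hx => ?_
      simpa using (hder x (Finset.mem_range.1 hx).le t ht).fun_pow 2
    simpa using ((hsum.const_mul (a / N)).const_mul 2).fun_add
      ((hasDerivWithinAt_id t (Icc 0 T)).const_mul (2 * ε ^ 2 + 2 * δ ^ 2))
  have hcont : ContinuousOn (fun t => (N : ℝ)⁻¹ * ∑ z ∈ Finset.range N,
      ((N : ℝ) * (e t (z + 1) - e t z) + D t z) ^ 2) (Icc 0 T) := by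
    refine continuousOn_const.mul (continuousOn_finsetSum _ fun z hz => ?_)
    have hz := Finset.mem_range.1 hz
    exact ((continuousOn_const.mul ((hec (z + 1) hz).sub (hec z hz.le))).add (hDc z hz)).pow 2
  have hle := integral_le_sub_of_hasDeriv_right_of_le hT
    (fun t ht => (hgd t ht).continuousWithinAt)
    (fun t ht => ((hgd t (Ioo_subset_Icc_self ht)).hasDerivAt
      (Icc_mem_nhds ht.1 ht.2)).hasDerivWithinAt)
    (hcont.integrableOn_compact isCompact_Icc) fun t ht => by
      have hE := discrete_energy_estimate (e t) (e' t) _ hN (hbdry t (Ioo_subset_Icc_self ht)).1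
        (hbdry t (Ioo_subset_Icc_self ht)).2 (fun x _ _ => rfl)
        (fun x h1 h2 => hres x h1 h2 t ht)
      have hterms : ∑ z ∈ Finset.range N, ((N : ℝ) * (e t (z + 1) - e t z) + D t z) ^ 2 ≤
          ∑ z ∈ Finset.range N, (2 * (N : ℝ) ^ 2 * (e t (z + 1) - e t z) ^ 2 + 2 * δ ^ 2) := by
        refine Finset.sum_le_sum fun z hz => ?_
        have hDz := abs_le.1 (hD z (Finset.mem_range.1 hz) t (Ioo_subset_Icc_self ht))
        nlinarith [sq_nonneg ((N : ℝ) * (e t (z + 1) - e t z) - D t z), sq_le_sq' hDz.1 hDz.2]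
      rw [Finset.sum_add_distrib, ← Finset.mul_sum, Finset.sum_const, Finset.card_range,
        nsmul_eq_mul] at hterms
      calc _ ≤ (N : ℝ)⁻¹ * (2 * (N : ℝ) ^ 2 * ∑ z ∈ Finset.range N, (e t (z + 1) - e t z) ^ 2
              + N * (2 * δ ^ 2)) := by gcongr
        _ = 2 * (N * ∑ z ∈ Finset.range N, (e t (z + 1) - e t z) ^ 2) + 2 * δ ^ 2 := by
            field_simp
        _ ≤ g' t := by
            simp only [g']
            linarith
  have hgT : g T = (2 * ε ^ 2 + 2 * δ ^ 2) * T := by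
    have h0 : ∑ x ∈ Finset.range N, e T x ^ 2 = 0 := Finset.sum_eq_zero fun x hx => by
      rw [hterm x (Finset.mem_range.1 hx).le, zero_pow two_ne_zero]
    simp [g, h0]
  have hg0 : 0 ≤ g 0 := by
    simp only [g, mul_zero, add_zero]
    positivity
  linarith

/-- Lemma 3.2, second conclusion (equation (3.16)): if `F^N` solves the discrete
backward equation `N^{−α} ∂_t F^N + Δ̃_N F^N = f` on `{1,…,N−1}` with Dirichlet
boundary conditions and terminal condition `F^N(T,·) = F(T,·)`, where `F(t,·)`
is the explicit Dirichlet solution of `∂_u²F(t,·) = f(t,·)` with space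
derivative `∂_uF = Fu`, then the discrete gradient of `F^N` converges to
`∂_uF` in space-time `L²`:
`∫₀^T N^{−1} Σ_{z=0}^{N−1} |N(F^N(t,(z+1)/N) − F^N(t,z/N)) − ∂_uF(t,z/N)|² dt → 0`. -/
theorem discrete_gradient_L2_convergence
    (α T : ℝ) (hα : 0 < α) (hT : 0 < T)
    (f : ℝ → ℝ → ℝ) (hf : ContDiff ℝ (⊤ : ℕ∞) (fun q : ℝ × ℝ => f q.1 q.2))
    (F : ℝ → ℝ → ℝ)
    (hF : ∀ t u : ℝ, F t u =
        (∫ v in (0:ℝ)..u, ∫ w in (0:ℝ)..v, f t w)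
          - u * ∫ v in (0:ℝ)..(1:ℝ), ∫ w in (0:ℝ)..v, f t w)
    (FN FN' : ℕ → ℝ → ℕ → ℝ)
    (hC1 : ∀ N : ℕ, 2 ≤ N → ∀ x ≤ N,
        ContinuousOn (fun t => FN' N t x) (Icc 0 T) ∧
        ∀ t ∈ Icc (0:ℝ) T,
          HasDerivWithinAt (fun s => FN N s x) (FN' N t x) (Icc 0 T) t)
    (hEq : ∀ N : ℕ, 2 ≤ N → ∀ x : ℕ, 1 ≤ x → x ≤ N - 1 → ∀ t ∈ Ioo (0:ℝ) T,
        (N : ℝ) ^ (-α) * FN' N t x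
          + (N : ℝ) ^ 2 * (FN N t (x + 1) + FN N t (x - 1) - 2 * FN N t x)
          = f t ((x : ℝ) / N))
    (hBdry : ∀ N : ℕ, 2 ≤ N → ∀ t ∈ Icc (0:ℝ) T, FN N t 0 = 0 ∧ FN N t N = 0)
    (hTerm : ∀ N : ℕ, 2 ≤ N → ∀ x ≤ N, FN N T x = F T ((x : ℝ) / N))
    (Fu : ℝ → ℝ → ℝ)
    (hFu : ∀ t : ℝ, ∀ u ∈ Icc (0:ℝ) 1,
        HasDerivWithinAt (F t) (Fu t u) (Icc 0 1) u) :
    Tendsto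
      (fun N : ℕ => ∫ t in (0:ℝ)..T, (N : ℝ)⁻¹ *
          ∑ z ∈ Finset.range N,
            ((N : ℝ) * (FN N t (z + 1) - FN N t z) - Fu t ((z : ℝ) / N)) ^ 2)
      atTop (nhds 0) := by
  have hfc : Continuous (Function.uncurry f) := hf.continuous
  have hslice : ∀ t, Continuous (f t) := fun t => hfc.comp (Continuous.prodMk_right t)
  obtain ⟨Ft, hFtc, hFt⟩ := exists_hasDerivAt_dirichlet_time (hf.of_le (by simp)) hF
  have hK : IsCompact (Icc (0:ℝ) T ×ˢ Icc (0:ℝ) 1) := isCompact_Icc.prod isCompact_Icc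
  obtain ⟨A, hA⟩ := hK.exists_bound_of_continuousOn hfc.continuousOn
  obtain ⟨B, hB⟩ := hK.exists_bound_of_continuousOn hFtc.continuousOn
  have hunif := Metric.uniformContinuousOn_iff_le.1
    (hK.uniformContinuousOn_of_continuous hfc.continuousOn)
  have hFu' : ∀ t, ∀ u ∈ Icc (0:ℝ) 1, Fu t u = (∫ w in (0:ℝ)..u, f t w)
      - ∫ v in (0:ℝ)..(1:ℝ), ∫ w in (0:ℝ)..v, f t w := fun t u hu =>
    (uniqueDiffOn_Icc zero_lt_one u hu).eq_deriv _ (hFu t u hu)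
      (hasDerivAt_dirichlet (hslice t) (hF t) u).hasDerivWithinAt
  have hFuc : ∀ u ∈ Icc (0:ℝ) 1, Continuous fun t => Fu t u := by
    intro u hu
    simp_rw [hFu' _ u hu]
    have h1 := continuous_parametric_primitive_of_continuous (μ := MeasureTheory.volume)
      (a₀ := 0) hfc
    have h2 := continuous_parametric_primitive_of_continuous (μ := MeasureTheory.volume)
      (a₀ := 0) (f := fun t v => ∫ w in (0:ℝ)..v, f t w) h1
    exact (h1.comp (Continuous.prodMk_left u)).sub (h2.comp (Continuous.prodMk_left 1))
  have hbound : ∀ η > 0, ∀ᶠ N : ℕ in atTop, (∫ t in (0:ℝ)..T, (N : ℝ)⁻¹ *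
      ∑ z ∈ Finset.range N,
        ((N : ℝ) * (FN N t (z + 1) - FN N t z) - Fu t ((z : ℝ) / N)) ^ 2) ≤ 10 * η ^ 2 * T := by
    intro η hη
    obtain ⟨ρ, hρ, hosc⟩ := hunif η hη
    have hinv : Tendsto (fun N : ℕ => (N : ℝ)⁻¹) atTop (nhds 0) :=
      tendsto_inv_atTop_zero.comp tendsto_natCast_atTop_atTop
    have hpow : Tendsto (fun N : ℕ => (N : ℝ) ^ (-α) * B) atTop (nhds 0) := by
      simpa using ((tendsto_rpow_neg_atTop hα).comp tendsto_natCast_atTop_atTop).mul_const B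
    have hinvA : Tendsto (fun N : ℕ => A * (N : ℝ)⁻¹) atTop (nhds 0) := by
      simpa using hinv.const_mul A
    filter_upwards [eventually_ge_atTop 2, hinv.eventually_le_const hρ,
      hpow.eventually_le_const hη, hinvA.eventually_le_const hη] with N hN2 hNρ hNB hNA
    have hN0 : (0 : ℝ) < N := by exact_mod_cast (by omega : 0 < N)
    have hmem : ∀ x ≤ N, (x : ℝ) / N ∈ Icc (0:ℝ) 1 := fun x hx =>
      ⟨by positivity, (div_le_one hN0).2 (by exact_mod_cast hx)⟩
    have hsucc : ∀ x : ℕ, ((x + 1 : ℕ) : ℝ) / N = (x : ℝ) / N + (N : ℝ)⁻¹ := fun x => by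
      push_cast
      rw [add_div, one_div]
    have hpred : ∀ x : ℕ, 1 ≤ x → ((x - 1 : ℕ) : ℝ) / N = (x : ℝ) / N - (N : ℝ)⁻¹ := fun x hx => by
      rw [Nat.cast_sub hx, Nat.cast_one, sub_div, one_div]
    let e : ℝ → ℕ → ℝ := fun t x => FN N t x - F t ((x : ℝ) / N)
    let e' : ℝ → ℕ → ℝ := fun t x => FN' N t x - Ft t ((x : ℝ) / N)
    let D : ℝ → ℕ → ℝ := fun t z =>
      (N : ℝ) * (F t (((z + 1 : ℕ) : ℝ) / N) - F t ((z : ℝ) / N)) - Fu t ((z : ℝ) / N)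
    have hint := integral_sq_gradient_le (N := N) (a := (N : ℝ) ^ (-α)) (T := T)
      (ε := 2 * η) (δ := η) (e := e) (e' := e') (D := D) (by omega) (by positivity) hT.le
      (fun x hx t ht => ((hC1 N hN2 x hx).2 t ht).sub (hFt t _).hasDerivWithinAt)
      ?_ ?_ ?_ ?_ ?_
    · calc _ = _ := by
            refine integral_congr fun t _ => ?_
            refine congrArg _ (Finset.sum_congr rfl fun z _ => ?_)
            simp only [e, D]
            ring
        _ ≤ _ := hint
        _ = _ := by ring
    · intro x hx1 hxN t ht
      have htI := Ioo_subset_Icc_self ht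
      have hx := hmem x (by omega)
      have hlo := (hmem (x - 1) (by omega)).1
      have hhi := (hmem (x + 1) (by omega)).2
      rw [hpred x hx1] at hlo
      rw [hsucc] at hhi
      have hsecond := abs_secondDifference_sub_le (hslice t) (hF t) (x := (x : ℝ) / N)
        (h := (N : ℝ)⁻¹) (η := η) (by positivity) fun w hw => by
          refine hosc (t, w) ⟨htI, hlo.trans hw.1, hw.2.trans hhi⟩ (t, (x : ℝ) / N) ⟨htI, hx⟩ ?_
          rw [Prod.dist_eq, dist_self, max_eq_right dist_nonneg, Real.dist_eq]
          exact (abs_le.2 ⟨by linarith [hw.1], by linarith [hw.2]⟩).trans hNρ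
      have hFtB : |(N : ℝ) ^ (-α) * Ft t ((x : ℝ) / N)| ≤ η := by
        rw [abs_mul, abs_of_nonneg (by positivity)]
        exact (mul_le_mul_of_nonneg_left (hB (t, (x : ℝ) / N) ⟨htI, hx⟩) (by positivity)).trans hNB
      have hlap : |(N : ℝ) ^ 2 * (F t (((x + 1 : ℕ) : ℝ) / N) + F t (((x - 1 : ℕ) : ℝ) / N)
          - 2 * F t ((x : ℝ) / N)) - f t ((x : ℝ) / N)| ≤ η := by
        rw [hsucc, hpred x hx1]
        have hmul := mul_le_mul_of_nonneg_left hsecond (by positivity : (0 : ℝ) ≤ (N : ℝ) ^ 2)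
        rw [← abs_of_nonneg (by positivity : (0 : ℝ) ≤ (N : ℝ) ^ 2), ← abs_mul,
          abs_of_nonneg (by positivity : (0 : ℝ) ≤ (N : ℝ) ^ 2)] at hmul
        have hNN : (N : ℝ) ^ 2 * (N : ℝ)⁻¹ ^ 2 = 1 := by field_simp
        refine le_of_eq_of_le (congrArg _ ?_) (hmul.trans_eq ?_)
        · linear_combination f t ((x : ℝ) / N) * hNN
        · linear_combination η * hNN
      have heq := hEq N hN2 x hx1 hxN t ht
      have hrepr : (N : ℝ) ^ (-α) * e' t x
          + (N : ℝ) ^ 2 * (e t (x + 1) + e t (x - 1) - 2 * e t x) =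
          -((N : ℝ) ^ (-α) * Ft t ((x : ℝ) / N))
          - ((N : ℝ) ^ 2 * (F t (((x + 1 : ℕ) : ℝ) / N) + F t (((x - 1 : ℕ) : ℝ) / N)
          - 2 * F t ((x : ℝ) / N)) - f t ((x : ℝ) / N)) := by
        simp only [e, e']
        linear_combination heq
      rw [hrepr]
      rw [abs_le] at hFtB hlap ⊢
      constructor <;> linarith [hFtB.1, hFtB.2, hlap.1, hlap.2]
    · intro t ht
      have h0 : F t 0 = 0 := by simp [hF]
      have h1 : F t 1 = 0 := by simp [hF]
      simp [e, hBdry N hN2 t ht, h0, h1, hN0.ne']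
    · intro x hx
      simp [e, hTerm N hN2 x hx]
    · intro z hz
      have hFc : ∀ u, Continuous fun t => F t u := fun u =>
        continuous_iff_continuousAt.2 fun t => (hFt t u).continuousAt
      exact ((continuous_const.mul ((hFc _).sub (hFc _))).sub
        (hFuc _ (hmem z hz.le))).continuousOn
    · intro z hz t ht
      have hhi := (hmem (z + 1) hz).2
      have hlo := (hmem z hz.le).1
      rw [hsucc] at hhi
      have hfirst := abs_difference_sub_le (hslice t) (hF t) (z := (z : ℝ) / N) (h := (N : ℝ)⁻¹)
        (M := A) (by positivity) fun w hw => hA (t, w) ⟨ht, hlo.trans hw.1, hw.2.trans hhi⟩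
      have hmul := mul_le_mul_of_nonneg_left hfirst hN0.le
      rw [← abs_of_nonneg hN0.le, ← abs_mul, abs_of_nonneg hN0.le] at hmul
      refine le_trans (le_of_eq_of_le ?_ hmul) (le_of_eq_of_le ?_ hNA)
      · simp only [D]
        rw [hsucc, hFu' t _ (hmem z hz.le)]
        congr 1
        field_simp
      · field_simp
  refine Metric.tendsto_nhds.2 fun ε hε => ?_
  have hη : 0 < √(ε / (20 * T)) := by positivity
  filter_upwards [hbound _ hη] with N hN
  rw [Real.sq_sqrt (by positivity)] at hN
  have hval : 10 * (ε / (20 * T)) * T = ε / 2 := by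
    field_simp
    norm_num
  have hnonneg : 0 ≤ ∫ t in (0:ℝ)..T, (N : ℝ)⁻¹ * ∑ z ∈ Finset.range N,
      ((N : ℝ) * (FN N t (z + 1) - FN N t z) - Fu t ((z : ℝ) / N)) ^ 2 :=
    integral_nonneg hT.le fun t _ => by positivity
  rw [Real.dist_eq, sub_zero, abs_of_nonneg hnonneg]
  linarith
end

section
/- Let N ≥ 2 be an integer, α ∈ ℝ, T > 0. Let e : [0,T]×{1,…,N−1} → ℝ be continuous in t for each x, and let G : [0,T]×{0,…,N} → ℝ be such that t ↦ G(t,x) is C¹ for each x, G(t,0) = G(t,N) = 0 for all t ∈ [0,T], G(T,x) = 0 for all x, and N^{−α} ∂_t G(t,x) + N²(G(t,x+1) + G(t,x−1) − 2G(t,x)) = −e(t,x) for all x ∈ {1,…,N−1} and t ∈ (0,T). Then (1/(2N^α)) · N^{−1} Σ_{x=1}^{N−1} G(0,x)² + ∫₀^T N^{−1} Σ_{x=0}^{N−1} [ N(G(t,x+1) − G(t,x)) ]² dt = ∫₀^T N^{−1} Σ_{x=1}^{N−1} e(t,x) G(t,x) dt. -/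
open Set intervalIntegral

/-- Summation by parts for the discrete Laplacian on `{1, …, n}`, with boundary terms. -/
theorem sum_Icc_discreteLaplacian_mul_self (f : ℕ → ℝ) (n : ℕ) :
    ∑ x ∈ Finset.Icc 1 n, (f (x + 1) + f (x - 1) - 2 * f x) * f x
      = f (n + 1) * (f (n + 1) - f n) - f 0 * (f 1 - f 0)
        - ∑ x ∈ Finset.range (n + 1), (f (x + 1) - f x) ^ 2 := by
  induction n with
  | zero => simp; ring
  | succ n ih =>
    rw [Finset.sum_Icc_succ_top (by omega), ih, Finset.sum_range_succ _ (n + 1)]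
    simp only [Nat.add_sub_cancel]
    ring

/-- Discrete energy identity (equation (3.19)): if `G` solves the discrete
backward heat equation `N^{−α} ∂_t G + Δ̃_N G = −e` on `{1,…,N−1}` with
homogeneous Dirichlet boundary conditions and zero terminal data, then
`(1/(2N^α)) N^{−1} Σ_{x=1}^{N−1} G(0,x)²
  + ∫₀^T N^{−1} Σ_{x=0}^{N−1} (N(G(t,x+1) − G(t,x)))² dt
  = ∫₀^T N^{−1} Σ_{x=1}^{N−1} e(t,x) G(t,x) dt`. -/
theorem discrete_energy_identity
    (N : ℕ) (hN : 2 ≤ N) (α T : ℝ) (hT : 0 < T)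
    (e : ℝ → ℕ → ℝ)
    (he : ∀ x : ℕ, 1 ≤ x → x ≤ N - 1 → ContinuousOn (fun t => e t x) (Icc 0 T))
    (G G' : ℝ → ℕ → ℝ)
    (hC1 : ∀ x ≤ N,
        ContinuousOn (fun t => G' t x) (Icc 0 T) ∧
        ∀ t ∈ Icc (0:ℝ) T,
          HasDerivWithinAt (fun s => G s x) (G' t x) (Icc 0 T) t)
    (hBdry : ∀ t ∈ Icc (0:ℝ) T, G t 0 = 0 ∧ G t N = 0)
    (hTerm : ∀ x ≤ N, G T x = 0)
    (hEq : ∀ x : ℕ, 1 ≤ x → x ≤ N - 1 → ∀ t ∈ Ioo (0:ℝ) T,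
        (N : ℝ) ^ (-α) * G' t x
          + (N : ℝ) ^ 2 * (G t (x + 1) + G t (x - 1) - 2 * G t x)
          = - e t x) :
    (1 / (2 * (N : ℝ) ^ α)) * (N : ℝ)⁻¹ * ∑ x ∈ Finset.Icc 1 (N - 1), (G 0 x) ^ 2
      + ∫ t in (0:ℝ)..T, (N : ℝ)⁻¹ *
          ∑ x ∈ Finset.range N, ((N : ℝ) * (G t (x + 1) - G t x)) ^ 2
      = ∫ t in (0:ℝ)..T, (N : ℝ)⁻¹ *
          ∑ x ∈ Finset.Icc 1 (N - 1), e t x * G t x := by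
  obtain ⟨n, rfl⟩ : ∃ n, N = n + 1 := ⟨N - 1, by omega⟩
  simp only [Nat.add_sub_cancel] at *
  have hNpos : (0 : ℝ) < ((n + 1 : ℕ) : ℝ) := by positivity
  generalize ((n + 1 : ℕ) : ℝ) = M at *
  have hGc : ∀ x ≤ n + 1, ContinuousOn (fun t => G t x) (Icc 0 T) :=
    fun x hx t ht => ((hC1 x hx).2 t ht).continuousWithinAt
  have hDc : ContinuousOn (fun t => M⁻¹ *
      ∑ x ∈ Finset.range (n + 1), (M * (G t (x + 1) - G t x)) ^ 2) (Icc 0 T) := by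
    refine continuousOn_const.mul (continuousOn_finsetSum _ fun x hx => ?_)
    have hx := Finset.mem_range.1 hx
    exact (continuousOn_const.mul ((hGc (x + 1) (by omega)).sub (hGc x (by omega)))).pow 2
  have hSc : ContinuousOn (fun t => M⁻¹ * ∑ x ∈ Finset.Icc 1 n, e t x * G t x) (Icc 0 T) := by
    refine continuousOn_const.mul (continuousOn_finsetSum _ fun x hx => ?_)
    have hx := Finset.mem_Icc.1 hx
    exact (he x hx.1 hx.2).mul (hGc x (by omega))
  have hDi := hDc.intervalIntegrable_of_Icc (μ := MeasureTheory.volume) hT.le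
  have hSi := hSc.intervalIntegrable_of_Icc (μ := MeasureTheory.volume) hT.le
  have hFc : ContinuousOn
      (fun t => (1 / (2 * M ^ α)) * M⁻¹ * ∑ x ∈ Finset.Icc 1 n, (G t x) ^ 2) (Icc 0 T) := by
    refine continuousOn_const.mul (continuousOn_finsetSum _ fun x hx => ?_)
    have hx := Finset.mem_Icc.1 hx
    exact (hGc x (by omega)).pow 2
  have hFd : ∀ t ∈ Ioo 0 T, HasDerivAt
      (fun t => (1 / (2 * M ^ α)) * M⁻¹ * ∑ x ∈ Finset.Icc 1 n, (G t x) ^ 2)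
      (M⁻¹ * ∑ x ∈ Finset.range (n + 1), (M * (G t (x + 1) - G t x)) ^ 2
        - M⁻¹ * ∑ x ∈ Finset.Icc 1 n, e t x * G t x) t := by
    intro t ht
    have hsum : HasDerivAt (fun t => ∑ x ∈ Finset.Icc 1 n, (G t x) ^ 2)
        (∑ x ∈ Finset.Icc 1 n, 2 * (G' t x * G t x)) t := by
      refine HasDerivAt.fun_sum fun x hx => ?_
      have hx := Finset.mem_Icc.1 hx
      have hd := ((hC1 x (by omega)).2 t (Ioo_subset_Icc_self ht)).hasDerivAt
        (Icc_mem_nhds ht.1 ht.2)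
      exact (hd.fun_pow 2).congr_deriv (by push_cast; ring)
    refine (hsum.const_mul ((1 / (2 * M ^ α)) * M⁻¹)).congr_deriv ?_
    have hparts := sum_Icc_discreteLaplacian_mul_self (G t) n
    obtain ⟨h0, h1⟩ := hBdry t (Ioo_subset_Icc_self ht)
    have hheat : M ^ (-α) * ∑ x ∈ Finset.Icc 1 n, G' t x * G t x
        + M ^ 2 * ∑ x ∈ Finset.Icc 1 n, (G t (x + 1) + G t (x - 1) - 2 * G t x) * G t x
        = - ∑ x ∈ Finset.Icc 1 n, e t x * G t x := by
      rw [Finset.mul_sum, Finset.mul_sum, ← Finset.sum_add_distrib, ← Finset.sum_neg_distrib]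
      refine Finset.sum_congr rfl fun x hx => ?_
      have hx := Finset.mem_Icc.1 hx
      linear_combination G t x * hEq x hx.1 hx.2 t ht
    rw [hparts, h0, h1, Real.rpow_neg hNpos.le] at hheat
    simp only [mul_pow]
    rw [← Finset.mul_sum, ← Finset.mul_sum]
    have hhalf : 1 / (2 * M ^ α) = (M ^ α)⁻¹ / 2 := by field_simp
    rw [hhalf]
    linear_combination M⁻¹ * hheat
  have hftc := integral_eq_sub_of_hasDerivAt_of_le hT.le hFc hFd (hDi.sub hSi)
  rw [integral_sub hDi hSi] at hftc
  have hzero : ∑ x ∈ Finset.Icc 1 n, (G T x) ^ 2 = 0 :=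
    Finset.sum_eq_zero fun x hx => by
      rw [hTerm x (by have := Finset.mem_Icc.1 hx; omega)]; norm_num
  rw [hzero] at hftc
  linear_combination hftc
end

section
/- Let k > 1/2 and α > 0. There exists a constant C > 0 such that for every integer N ≥ 1: Σ_{p=0}^{∞} Σ_{q=1}^{N} (2Np + q)^{−2k} · ( N² sin²(πq/N) + N^{−α} ) / ( N⁴ sin⁴(πq/(2N)) ) ≤ C. -/
/-- The Jordan inequality on the grid: `q ≤ N sin (πq / (2N))` for `0 ≤ q ≤ N`. -/
lemma natCast_le_mul_sin_pi_mul_div {N q : ℕ} (hN : 1 ≤ N) (hqN : q ≤ N) :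
    (q : ℝ) ≤ N * Real.sin (Real.pi * q / (2 * N)) := by
  have hN0 : (0 : ℝ) < N := by exact_mod_cast hN
  have hqN' : (q : ℝ) ≤ N := by exact_mod_cast hqN
  have hle : Real.pi * q / (2 * N) ≤ Real.pi / 2 := by
    rw [div_le_div_iff₀ (by positivity) two_pos]
    nlinarith [mul_le_mul_of_nonneg_left hqN' Real.pi_pos.le]
  have hsin := mul_le_mul_of_nonneg_left (Real.mul_le_sin (by positivity) hle) hN0.le
  refine le_of_eq_of_le ?_ hsin
  have := Real.pi_ne_zero
  field_simp

lemma sin_weight_le {α : ℝ} (hα : 0 ≤ α) {N q : ℕ} (hq : 1 ≤ q) (hqN : q ≤ N) :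
    ((N : ℝ) ^ 2 * Real.sin (Real.pi * q / N) ^ 2 + (N : ℝ) ^ (-α)) /
      ((N : ℝ) ^ 4 * Real.sin (Real.pi * q / (2 * N)) ^ 4) ≤ 5 * (1 / (q : ℝ) ^ 2) := by
  have hN : 1 ≤ N := hq.trans hqN
  have hN1 : (1 : ℝ) ≤ N := by exact_mod_cast hN
  have hq1 : (1 : ℝ) ≤ q := by exact_mod_cast hq
  have hdouble : Real.sin (Real.pi * q / N) =
      2 * Real.sin (Real.pi * q / (2 * N)) * Real.cos (Real.pi * q / (2 * N)) := by
    rw [← Real.sin_two_mul]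
    congr 1
    field_simp
  have hJordan := natCast_le_mul_sin_pi_mul_div hN hqN
  have hα1 : (N : ℝ) ^ (-α) ≤ 1 := Real.rpow_le_one_of_one_le_of_nonpos hN1 (by linarith)
  rw [hdouble]
  set s := Real.sin (Real.pi * q / (2 * N))
  set c := Real.cos (Real.pi * q / (2 * N))
  have hc : c ^ 2 ≤ 1 := Real.cos_sq_le_one _
  have hsq : (q : ℝ) ^ 2 ≤ (N * s) ^ 2 := pow_le_pow_left₀ (by positivity) hJordan 2
  have hq2 : (1 : ℝ) ≤ (q : ℝ) ^ 2 := one_le_pow₀ hq1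
  have hden : (N : ℝ) ^ 4 * s ^ 4 = (N * s) ^ 2 * (N * s) ^ 2 := by ring
  have hnum : (N : ℝ) ^ 2 * (2 * s * c) ^ 2 + (N : ℝ) ^ (-α) ≤ 5 * (N * s) ^ 2 := by
    nlinarith [mul_le_mul_of_nonneg_left hc (sq_nonneg (N * s))]
  have hpos : 0 < ((N : ℝ) * s) ^ 2 := by linarith
  calc _ ≤ 5 * (N * s) ^ 2 / ((N * s) ^ 2 * (N * s) ^ 2) := by rw [hden]; gcongr
    _ = 5 * (1 / (N * s) ^ 2) := by field_simp
    _ ≤ _ := by gcongr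

/-- Uniform-in-`N` bound on the sum `S₁^A` in the proof of the tightness lemma:
for `k > 1/2` and `α > 0` there is a constant `C > 0` such that for every
`N ≥ 1`,
`Σ_{p=0}^∞ Σ_{q=1}^{N} (2Np+q)^{−2k} (N² sin²(πq/N) + N^{−α}) / (N⁴ sin⁴(πq/(2N))) ≤ C`. -/
theorem tightness_sum_bound_A
    (k α : ℝ) (hk : 1 / 2 < k) (hα : 0 < α) :
    ∃ C : ℝ, 0 < C ∧ ∀ N : ℕ, 1 ≤ N →
      Summable (fun p : ℕ => ∑ q ∈ Finset.Icc 1 N,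
        ((2 * N * p + q : ℕ) : ℝ) ^ (-(2 * k)) *
          (((N : ℝ) ^ 2 * Real.sin (Real.pi * q / N) ^ 2 + (N : ℝ) ^ (-α)) /
            ((N : ℝ) ^ 4 * Real.sin (Real.pi * q / (2 * N)) ^ 4))) ∧
      (∑' p : ℕ, ∑ q ∈ Finset.Icc 1 N,
        ((2 * N * p + q : ℕ) : ℝ) ^ (-(2 * k)) *
          (((N : ℝ) ^ 2 * Real.sin (Real.pi * q / N) ^ 2 + (N : ℝ) ^ (-α)) /
            ((N : ℝ) ^ 4 * Real.sin (Real.pi * q / (2 * N)) ^ 4))) ≤ C := by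
  have hsq : Summable (fun q : ℕ => 1 / (q : ℝ) ^ 2) :=
    Real.summable_one_div_nat_pow.2 one_lt_two
  have hrpow : Summable (fun p : ℕ => ((p + 1 : ℕ) : ℝ) ^ (-(2 * k))) :=
    (summable_nat_add_iff (f := fun p : ℕ => (p : ℝ) ^ (-(2 * k))) 1).2
      (Real.summable_nat_rpow.2 (by linarith))
  set A : ℝ := 5 * ∑' q : ℕ, 1 / (q : ℝ) ^ 2
  have hA : 0 ≤ A := mul_nonneg (by norm_num) (tsum_nonneg fun q => by positivity)
  have hB : 0 ≤ ∑' p : ℕ, ((p + 1 : ℕ) : ℝ) ^ (-(2 * k)) := tsum_nonneg fun p => by positivity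
  refine ⟨(∑' p : ℕ, ((p + 1 : ℕ) : ℝ) ^ (-(2 * k))) * A + 1, by positivity, fun N hN => ?_⟩
  have hbound : ∀ p : ℕ, ∑ q ∈ Finset.Icc 1 N,
      ((2 * N * p + q : ℕ) : ℝ) ^ (-(2 * k)) *
        (((N : ℝ) ^ 2 * Real.sin (Real.pi * q / N) ^ 2 + (N : ℝ) ^ (-α)) /
          ((N : ℝ) ^ 4 * Real.sin (Real.pi * q / (2 * N)) ^ 4)) ≤
      ((p + 1 : ℕ) : ℝ) ^ (-(2 * k)) * A := by
    intro p
    calc _ ≤ ∑ q ∈ Finset.Icc 1 N,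
          ((p + 1 : ℕ) : ℝ) ^ (-(2 * k)) * (5 * (1 / (q : ℝ) ^ 2)) := by
          refine Finset.sum_le_sum fun q hq => ?_
          obtain ⟨hq1, hqN⟩ := Finset.mem_Icc.1 hq
          have hle : p + 1 ≤ 2 * N * p + q := by nlinarith [Nat.mul_le_mul_right p hN]
          refine mul_le_mul ?_ (sin_weight_le hα.le hq1 hqN) (by positivity) (by positivity)
          exact Real.rpow_le_rpow_of_nonpos (by positivity) (by exact_mod_cast hle) (by linarith)
      _ = ((p + 1 : ℕ) : ℝ) ^ (-(2 * k)) * (5 * ∑ q ∈ Finset.Icc 1 N, 1 / (q : ℝ) ^ 2) := by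
          rw [← Finset.mul_sum, ← Finset.mul_sum]
      _ ≤ _ := by
          gcongr
          exact mul_le_mul_of_nonneg_left
            (hsq.sum_le_tsum _ fun q _ => by positivity) (by norm_num)
  have hsum := Summable.of_nonneg_of_le
    (fun p => Finset.sum_nonneg fun q _ => by positivity) hbound (hrpow.mul_right A)
  refine ⟨hsum, ?_⟩
  calc _ ≤ ∑' p : ℕ, ((p + 1 : ℕ) : ℝ) ^ (-(2 * k)) * A :=
        hsum.tsum_le_tsum hbound (hrpow.mul_right A)
    _ = (∑' p : ℕ, ((p + 1 : ℕ) : ℝ) ^ (-(2 * k))) * A := tsum_mul_right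
    _ ≤ _ := by linarith
end

section
/- Let k > 1/2 and α > 0. There exists a constant C > 0 such that for every integer N ≥ 2: Σ_{p=0}^{∞} Σ_{q=N+1}^{2N−1} (2Np + q)^{−2k} · ( N² sin²(πq/N) + N^{−α} ) / ( N⁴ sin⁴(πq/(2N)) ) ≤ C. -/
/-- Jordan's inequality near `π`: if `N < q < 2N` then `N sin (πq / (2N)) ≥ 2N - q`. -/
lemma two_mul_sub_le_mul_sin {N q : ℕ} (hN : N < q) (hq : q < 2 * N) :
    ((2 * N - q : ℕ) : ℝ) ≤ N * Real.sin (Real.pi * q / (2 * N)) := by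
  have hN0 : (0 : ℝ) < N := by exact_mod_cast (by omega : 0 < N)
  have hqN : (N : ℝ) < q := by exact_mod_cast hN
  have hq2 : (q : ℝ) < 2 * N := by exact_mod_cast hq
  rw [Nat.cast_sub hq.le]
  push_cast
  have hx : Real.pi * q / (2 * N) = Real.pi - Real.pi / 2 * ((2 * N - q) / N) := by
    field_simp
    ring
  have ht0 : 0 ≤ (2 * (N : ℝ) - q) / N := div_nonneg (by linarith) hN0.le
  have ht1 : (2 * (N : ℝ) - q) / N ≤ 1 := (div_le_one hN0).2 (by linarith)
  rw [hx, Real.sin_pi_sub]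
  have h := Real.mul_le_sin (x := Real.pi / 2 * ((2 * N - q) / N))
    (by positivity) (mul_le_of_le_one_right (by positivity) ht1)
  have h' : 2 / Real.pi * (Real.pi / 2 * ((2 * (N : ℝ) - q) / N)) = (2 * N - q) / N := by
    field_simp
  rw [h', div_le_iff₀ hN0] at h
  linarith

/-- The trigonometric weight at `q` is controlled by the inverse square of the distance from `q`
to `2N`. -/
lemma trig_weight_le {N q : ℕ} (hN : N < q) (hq : q < 2 * N) {α : ℝ} (hα : 0 ≤ α) :
    ((N : ℝ) ^ 2 * Real.sin (Real.pi * q / N) ^ 2 + (N : ℝ) ^ (-α)) /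
      ((N : ℝ) ^ 4 * Real.sin (Real.pi * q / (2 * N)) ^ 4) ≤
      5 * (1 / ((2 * N - q : ℕ) : ℝ) ^ 2) := by
  have hN1 : (1 : ℝ) ≤ N := by exact_mod_cast (by omega : 1 ≤ N)
  have hm1 : (1 : ℝ) ≤ ((2 * N - q : ℕ) : ℝ) := by exact_mod_cast (by omega : 1 ≤ 2 * N - q)
  have hs := two_mul_sub_le_mul_sin hN hq
  have hpow : (N : ℝ) ^ (-α) ≤ 1 := Real.rpow_le_one_of_one_le_of_nonpos hN1 (by linarith)
  have hdouble : Real.pi * q / N = 2 * (Real.pi * q / (2 * N)) := by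
    field_simp
  rw [hdouble, Real.sin_two_mul]
  set s := Real.sin (Real.pi * q / (2 * N))
  set c := Real.cos (Real.pi * q / (2 * N))
  set m := ((2 * N - q : ℕ) : ℝ)
  have hc : c ^ 2 ≤ 1 := Real.cos_sq_le_one _
  have hmsq : m ^ 2 ≤ (N * s) ^ 2 := by gcongr
  have hone : 1 ≤ (N * s) ^ 2 := (one_le_pow₀ hm1).trans hmsq
  have hnum : (N : ℝ) ^ 2 * (2 * s * c) ^ 2 + (N : ℝ) ^ (-α) ≤ 5 * (N * s) ^ 2 := by
    nlinarith [mul_le_mul_of_nonneg_left hc (sq_nonneg (N * s))]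
  have hsq : (N : ℝ) ^ 4 * s ^ 4 = (N * s) ^ 2 * (N * s) ^ 2 := by ring
  calc _ ≤ 5 * (N * s) ^ 2 / ((N : ℝ) ^ 4 * s ^ 4) := by gcongr
    _ = 5 * (1 / (N * s) ^ 2) := by
      rw [hsq]
      have : (N * s) ^ 2 ≠ 0 := by positivity
      field_simp
    _ ≤ 5 * (1 / m ^ 2) := by gcongr

lemma sum_one_div_two_mul_sub_sq_le_tsum (N : ℕ) :
    ∑ q ∈ Finset.Icc (N + 1) (2 * N - 1), 1 / ((2 * N - q : ℕ) : ℝ) ^ 2 ≤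
      ∑' m : ℕ, 1 / (m : ℝ) ^ 2 := by
  have hinj : Set.InjOn (fun q => 2 * N - q) (Finset.Icc (N + 1) (2 * N - 1) : Set ℕ) := by
    intro a ha b hb hab
    simp only [Finset.coe_Icc, Set.mem_Icc] at ha hb hab
    omega
  rw [← Finset.sum_image (f := fun m : ℕ => 1 / (m : ℝ) ^ 2) hinj]
  exact (Real.summable_one_div_nat_pow.2 one_lt_two).sum_le_tsum _ fun _ _ => by positivity

/-- Uniform-in-`N` bound on the sum `S₁^B` in the proof of the tightness lemma:
for `k > 1/2` and `α > 0` there is a constant `C > 0` such that for every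
`N ≥ 2`,
`Σ_{p=0}^∞ Σ_{q=N+1}^{2N−1} (2Np+q)^{−2k} (N² sin²(πq/N) + N^{−α}) / (N⁴ sin⁴(πq/(2N))) ≤ C`. -/
theorem tightness_sum_bound_B
    (k α : ℝ) (hk : 1 / 2 < k) (hα : 0 < α) :
    ∃ C : ℝ, 0 < C ∧ ∀ N : ℕ, 2 ≤ N →
      Summable (fun p : ℕ => ∑ q ∈ Finset.Icc (N + 1) (2 * N - 1),
        ((2 * N * p + q : ℕ) : ℝ) ^ (-(2 * k)) *
          (((N : ℝ) ^ 2 * Real.sin (Real.pi * q / N) ^ 2 + (N : ℝ) ^ (-α)) /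
            ((N : ℝ) ^ 4 * Real.sin (Real.pi * q / (2 * N)) ^ 4))) ∧
      (∑' p : ℕ, ∑ q ∈ Finset.Icc (N + 1) (2 * N - 1),
        ((2 * N * p + q : ℕ) : ℝ) ^ (-(2 * k)) *
          (((N : ℝ) ^ 2 * Real.sin (Real.pi * q / N) ^ 2 + (N : ℝ) ^ (-α)) /
            ((N : ℝ) ^ 4 * Real.sin (Real.pi * q / (2 * N)) ^ 4))) ≤ C := by
  have hp : Summable (fun p : ℕ => ((p + 1 : ℕ) : ℝ) ^ (-(2 * k))) :=
    (summable_nat_add_iff 1).2 (Real.summable_nat_rpow.2 (by linarith))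
  set T := ∑' m : ℕ, 1 / (m : ℝ) ^ 2
  have hT : 0 ≤ T := tsum_nonneg fun _ => by positivity
  have hP : 0 ≤ ∑' p : ℕ, ((p + 1 : ℕ) : ℝ) ^ (-(2 * k)) := tsum_nonneg fun _ => by positivity
  refine ⟨(∑' p : ℕ, ((p + 1 : ℕ) : ℝ) ^ (-(2 * k))) * (5 * T) + 1, by positivity, ?_⟩
  intro N hN
  have hle (p : ℕ) : ∑ q ∈ Finset.Icc (N + 1) (2 * N - 1),
        ((2 * N * p + q : ℕ) : ℝ) ^ (-(2 * k)) *
          (((N : ℝ) ^ 2 * Real.sin (Real.pi * q / N) ^ 2 + (N : ℝ) ^ (-α)) /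
            ((N : ℝ) ^ 4 * Real.sin (Real.pi * q / (2 * N)) ^ 4)) ≤
      ((p + 1 : ℕ) : ℝ) ^ (-(2 * k)) * (5 * T) := by
    calc _ ≤ ∑ q ∈ Finset.Icc (N + 1) (2 * N - 1),
          ((p + 1 : ℕ) : ℝ) ^ (-(2 * k)) * (5 * (1 / ((2 * N - q : ℕ) : ℝ) ^ 2)) := by
          refine Finset.sum_le_sum fun q hq => ?_
          rw [Finset.mem_Icc] at hq
          have hpq : p + 1 ≤ 2 * N * p + q := by nlinarith
          refine mul_le_mul ?_ (trig_weight_le (by omega) (by omega) hα.le)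
            (by positivity) (by positivity)
          exact Real.rpow_le_rpow_of_nonpos (by positivity) (by exact_mod_cast hpq) (by linarith)
      _ ≤ _ := by
          rw [← Finset.mul_sum, ← Finset.mul_sum]
          gcongr
          exact sum_one_div_two_mul_sub_sq_le_tsum N
  have hmaj := hp.mul_right (5 * T)
  have hsum := Summable.of_nonneg_of_le
    (fun p => Finset.sum_nonneg fun q _ => by positivity) hle hmaj
  refine ⟨hsum, (hsum.tsum_le_tsum hle hmaj).trans ?_⟩
  rw [tsum_mul_right]
  linarith
end

section
/- Let k > 1/2 and α > 0. There exists a constant C > 0 such that for every integer N ≥ 1: Σ over all integers z ≥ 1 that are not multiples of 2N of z^{−2k} · ( N² sin²(πz/N) + N^{−α} ) / ( N⁴ sin⁴(πz/(2N)) ) ≤ C. -/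
/-- If `m ∤ z`, then `|sin (π z / m)| ≥ 2 / m`, in squared form. -/
lemma four_le_sq_mul_sin_sq {m z : ℕ} (hm : 0 < m) (hz : ¬ m ∣ z) :
    4 ≤ (m : ℝ) ^ 2 * Real.sin (Real.pi * z / m) ^ 2 := by
  have hm0 : (0 : ℝ) < m := by exact_mod_cast hm
  have hπ := Real.pi_pos
  have hq1 : 1 ≤ z % m := Nat.one_le_iff_ne_zero.2 fun h => hz (Nat.dvd_of_mod_eq_zero h)
  have hqm : z % m + 1 ≤ m := Nat.mod_lt z hm
  have hdecomp : (z : ℝ) = (z % m : ℕ) + m * (z / m : ℕ) := by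
    exact_mod_cast (Nat.mod_add_div z m).symm
  set q := z % m
  set p := z / m
  have hq1' : (1 : ℝ) ≤ q := by exact_mod_cast hq1
  have hqm' : (q : ℝ) + 1 ≤ m := by exact_mod_cast hqm
  have hperiod : Real.sin (Real.pi * z / m) ^ 2 = Real.sin (Real.pi * q / m) ^ 2 := by
    have harg : Real.pi * z / m = Real.pi * q / m + p * Real.pi := by
      rw [hdecomp]
      field_simp
    rw [harg, Real.sin_add_nat_mul_pi, mul_pow, ← pow_mul, mul_comm p 2, pow_mul]
    norm_num
  have hsin : 2 / (m : ℝ) ≤ Real.sin (Real.pi * q / m) := by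
    rcases le_total (2 * (q : ℝ)) m with h | h
    · have hle : Real.pi * q / m ≤ Real.pi / 2 := by
        rw [div_le_div_iff₀ hm0 two_pos]
        nlinarith
      calc 2 / (m : ℝ) ≤ 2 * q / m := by gcongr; linarith
        _ = 2 / Real.pi * (Real.pi * q / m) := by field_simp
        _ ≤ _ := Real.mul_le_sin (by positivity) hle
    · have harg : Real.pi - Real.pi * q / m = Real.pi * (m - q) / m := by field_simp
      have hnonneg : 0 ≤ Real.pi * ((m : ℝ) - q) / m :=
        div_nonneg (mul_nonneg hπ.le (by linarith)) hm0.le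
      have hle : Real.pi * ((m : ℝ) - q) / m ≤ Real.pi / 2 := by
        rw [div_le_div_iff₀ hm0 two_pos]
        nlinarith
      rw [← Real.sin_pi_sub, harg]
      calc 2 / (m : ℝ) ≤ 2 * (m - q) / m := by gcongr; linarith
        _ = 2 / Real.pi * (Real.pi * (m - q) / m) := by field_simp
        _ ≤ _ := Real.mul_le_sin hnonneg hle
  rw [hperiod, ← mul_pow]
  have htwo : 2 ≤ (m : ℝ) * Real.sin (Real.pi * q / m) := by
    rwa [div_le_iff₀' hm0] at hsin
  nlinarith

/-- For `z` not a multiple of `2N`, the factor multiplying `z ^ (-2k)` is at most `5`. -/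
lemma sin_ratio_le_five {N z : ℕ} {α : ℝ} (hα : 0 ≤ α) (hN : 1 ≤ N) (hz : ¬ 2 * N ∣ z) :
    ((N : ℝ) ^ 2 * Real.sin (Real.pi * z / N) ^ 2 + (N : ℝ) ^ (-α)) /
      ((N : ℝ) ^ 4 * Real.sin (Real.pi * z / (2 * N)) ^ 4) ≤ 5 := by
  have hN1 : (1 : ℝ) ≤ N := by exact_mod_cast hN
  have hlower := four_le_sq_mul_sin_sq (by omega) hz
  push_cast at hlower
  have hdouble : Real.pi * z / N = 2 * (Real.pi * z / (2 * N)) := by field_simp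
  rw [hdouble, Real.sin_two_mul]
  set x := Real.pi * z / (2 * N)
  have hpow : (N : ℝ) ^ (-α) ≤ 1 := Real.rpow_le_one_of_one_le_of_nonpos hN1 (by linarith)
  have hone : 1 ≤ (N : ℝ) ^ 2 * Real.sin x ^ 2 := by linarith
  have hden : (N : ℝ) ^ 4 * Real.sin x ^ 4 = ((N : ℝ) ^ 2 * Real.sin x ^ 2) ^ 2 := by ring
  have hnum : (N : ℝ) ^ 2 * (2 * Real.sin x * Real.cos x) ^ 2 =
      4 * ((N : ℝ) ^ 2 * Real.sin x ^ 2) * Real.cos x ^ 2 := by ring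
  rw [hden, hnum, div_le_iff₀ (by positivity)]
  set t := (N : ℝ) ^ 2 * Real.sin x ^ 2
  have hcos : t * Real.cos x ^ 2 ≤ t := mul_le_of_le_one_right (by linarith) (Real.cos_sq_le_one x)
  nlinarith

/-- Uniform-in-`N` bound on the sum `S₁` in the proof of the tightness lemma:
for `k > 1/2` and `α > 0` there is a constant `C > 0` such that for every
`N ≥ 1`, the sum over all integers `z ≥ 1` that are not multiples of `2N` of
`z^{−2k} (N² sin²(πz/N) + N^{−α}) / (N⁴ sin⁴(πz/(2N)))` is at most `C`. -/
theorem tightness_sum_bound_S1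
    (k α : ℝ) (hk : 1 / 2 < k) (hα : 0 < α) :
    ∃ C : ℝ, 0 < C ∧ ∀ N : ℕ, 1 ≤ N →
      Summable (fun z : {z : ℕ // 1 ≤ z ∧ ¬ (2 * N ∣ z)} =>
        ((z : ℕ) : ℝ) ^ (-(2 * k)) *
          (((N : ℝ) ^ 2 * Real.sin (Real.pi * (z : ℕ) / N) ^ 2 + (N : ℝ) ^ (-α)) /
            ((N : ℝ) ^ 4 * Real.sin (Real.pi * (z : ℕ) / (2 * N)) ^ 4))) ∧
      (∑' z : {z : ℕ // 1 ≤ z ∧ ¬ (2 * N ∣ z)},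
        ((z : ℕ) : ℝ) ^ (-(2 * k)) *
          (((N : ℝ) ^ 2 * Real.sin (Real.pi * (z : ℕ) / N) ^ 2 + (N : ℝ) ^ (-α)) /
            ((N : ℝ) ^ 4 * Real.sin (Real.pi * (z : ℕ) / (2 * N)) ^ 4))) ≤ C := by
  have hsum : Summable fun z : ℕ => (z : ℝ) ^ (-(2 * k)) * 5 :=
    (Real.summable_nat_rpow.2 (by linarith)).mul_right 5
  have hnonneg : ∀ z : ℕ, 0 ≤ (z : ℝ) ^ (-(2 * k)) * 5 := fun z => by positivity
  refine ⟨(∑' z : ℕ, (z : ℝ) ^ (-(2 * k)) * 5) + 1,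
    add_pos_of_nonneg_of_pos (tsum_nonneg hnonneg) one_pos, fun N hN => ?_⟩
  have hsub := hsum.comp_injective
    (Subtype.val_injective (p := fun z : ℕ => 1 ≤ z ∧ ¬ 2 * N ∣ z))
  have hle : ∀ z : {z : ℕ // 1 ≤ z ∧ ¬ (2 * N ∣ z)},
      ((z : ℕ) : ℝ) ^ (-(2 * k)) *
          (((N : ℝ) ^ 2 * Real.sin (Real.pi * (z : ℕ) / N) ^ 2 + (N : ℝ) ^ (-α)) /
            ((N : ℝ) ^ 4 * Real.sin (Real.pi * (z : ℕ) / (2 * N)) ^ 4)) ≤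
        ((z : ℕ) : ℝ) ^ (-(2 * k)) * 5 := fun z =>
    mul_le_mul_of_nonneg_left (sin_ratio_le_five hα.le hN z.2.2) (by positivity)
  have hterms := Summable.of_nonneg_of_le (fun z => by positivity) hle hsub
  refine ⟨hterms, (hterms.tsum_le_tsum hle hsub).trans ?_⟩
  have htsum := hsum.tsum_subtype_le (fun z : ℕ => (z : ℝ) ^ (-(2 * k)) * 5)
    {z | 1 ≤ z ∧ ¬ 2 * N ∣ z} hnonneg
  exact htsum.trans (by linarith)
end

section
/- Let m > 1/2, k > 1/2 and α > 0. There exists a constant C > 0 such that for every integer N ≥ 1: Σ_{n ∈ ℤ} Σ over integers z ≥ 1 that are not multiples of 2N of (n² + 1)^{−m} · z^{−2k} · ( N² sin²(πz/N) + N^{−α} ) / ( n² N^{−2α} + N⁴ sin⁴(πz/(2N)) ) ≤ C. -/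
/-- If `2 * N` does not divide `z`, then `N * |sin (π z / (2 N))|` is at least one. -/
lemma one_le_sq_mul_sin_sq {N z : ℕ} (hN : 1 ≤ N) (hz : ¬ 2 * N ∣ z) :
    1 ≤ (N : ℝ) ^ 2 * Real.sin (Real.pi * z / (2 * N)) ^ 2 := by
  have hN0 : (0 : ℝ) < N := by exact_mod_cast hN
  have hπ := Real.pi_pos
  have hr1 : 1 ≤ z % (2 * N) := by
    have := mt Nat.dvd_of_mod_eq_zero hz
    omega
  have hr2 : z % (2 * N) + 1 ≤ 2 * N := Nat.mod_lt _ (by omega)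
  have hz' : (z : ℝ) = 2 * N * (z / (2 * N) : ℕ) + (z % (2 * N) : ℕ) := by
    exact_mod_cast (Nat.div_add_mod z (2 * N)).symm
  generalize z % (2 * N) = r at hr1 hr2 hz'
  generalize z / (2 * N) = q at hz'
  have hr1' : (1 : ℝ) ≤ r := by exact_mod_cast hr1
  have hr2' : (r : ℝ) + 1 ≤ 2 * N := by exact_mod_cast hr2
  have jordan : ∀ t : ℝ, 1 ≤ t → t ≤ N → 1 ≤ N * Real.sin (Real.pi * t / (2 * N)) := by
    intro t ht1 htN
    have h := Real.mul_le_sin (x := Real.pi * t / (2 * N)) (by positivity)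
      (by rw [div_le_div_iff₀ (by positivity) two_pos]; nlinarith)
    have e : 2 / Real.pi * (Real.pi * t / (2 * N)) = t / N := by field_simp
    rw [e, div_le_iff₀ hN0] at h
    linarith
  have hsin : 1 ≤ N * Real.sin (Real.pi * r / (2 * N)) := by
    rcases le_total (r : ℝ) N with h | h
    · exact jordan r hr1' h
    · have e : Real.pi * r / (2 * N) = Real.pi - Real.pi * (2 * N - r) / (2 * N) := by
        field_simp
        ring
      rw [e, Real.sin_pi_sub]
      exact jordan _ (by linarith) (by linarith)
  have e : Real.pi * z / (2 * N) = Real.pi * r / (2 * N) + q * Real.pi := by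
    rw [hz']
    field_simp
    ring
  rw [e, Real.sin_add_nat_mul_pi, mul_pow ((-1 : ℝ) ^ q), ← pow_mul, mul_comm q, pow_mul,
    neg_one_sq, one_pow, one_mul, ← mul_pow]
  exact one_le_pow₀ hsin

/-- The quotient in the second moment bound is at most `5`, uniformly in both modes. -/
lemma moment_quotient_le {N z : ℕ} {α : ℝ} (hα : 0 ≤ α) (hN : 1 ≤ N) (hz : ¬ 2 * N ∣ z) (x : ℝ) :
    ((N : ℝ) ^ 2 * Real.sin (Real.pi * z / N) ^ 2 + (N : ℝ) ^ (-α)) /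
      (x ^ 2 * (N : ℝ) ^ (-(2 * α)) + (N : ℝ) ^ 4 * Real.sin (Real.pi * z / (2 * N)) ^ 4) ≤ 5 := by
  have hA := one_le_sq_mul_sin_sq hN hz
  have hN1 : (1 : ℝ) ≤ N := by exact_mod_cast hN
  have hNα : (N : ℝ) ^ (-α) ≤ 1 := Real.rpow_le_one_of_one_le_of_nonpos hN1 (by linarith)
  have hx : 0 ≤ x ^ 2 * (N : ℝ) ^ (-(2 * α)) := by positivity
  have hdouble : Real.pi * z / N = 2 * (Real.pi * z / (2 * N)) := by field_simp
  rw [hdouble, Real.sin_two_mul]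
  generalize Real.pi * z / (2 * N) = y at hA ⊢
  have hcos : (N : ℝ) ^ 2 * (2 * Real.sin y * Real.cos y) ^ 2 ≤ 4 * (N ^ 2 * Real.sin y ^ 2) := by
    have := mul_le_mul_of_nonneg_left (Real.cos_sq_le_one y)
      (by positivity : 0 ≤ 4 * ((N : ℝ) ^ 2 * Real.sin y ^ 2))
    linarith
  have hfour : (N : ℝ) ^ 4 * Real.sin y ^ 4 = (N ^ 2 * Real.sin y ^ 2) ^ 2 := by ring
  rw [hfour]
  rw [div_le_iff₀ (by positivity)]
  nlinarith

/-- The weights `(n² + 1)^(-m)` are summable over the integers for `m > 1/2`. -/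
lemma summable_int_sq_add_one_rpow {m : ℝ} (hm : 1 / 2 < m) :
    Summable fun n : ℤ => ((n : ℝ) ^ 2 + 1) ^ (-m) := by
  refine (Real.summable_abs_int_rpow (b := 2 * m) (by linarith)).of_norm_bounded_eventually ?_
  filter_upwards [(Set.finite_singleton (0 : ℤ)).compl_mem_cofinite] with n hn
  have hn0 : (n : ℝ) ≠ 0 := by simpa using hn
  have hpos : 0 < (n : ℝ) ^ 2 := by positivity
  rw [Real.norm_of_nonneg (by positivity)]
  calc ((n : ℝ) ^ 2 + 1) ^ (-m) ≤ ((n : ℝ) ^ 2) ^ (-m) :=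
        Real.rpow_le_rpow_of_nonpos hpos (by linarith) (by linarith)
    _ = |(n : ℝ)| ^ (-(2 * m)) := by
        rw [← sq_abs, ← Real.rpow_natCast, ← Real.rpow_mul (abs_nonneg _)]
        congr 1
        push_cast
        ring

/-- Comparison of a nonnegative series with a summable one along an injection of index types. -/
lemma summable_and_tsum_le_of_injective {ι κ : Type*} {f : ι → ℝ} {g : κ → ℝ} {e : ι → κ}
    (he : Function.Injective e) (hg : Summable g) (hg0 : ∀ j, 0 ≤ g j) (hf0 : ∀ i, 0 ≤ f i)
    (hfg : ∀ i, f i ≤ g (e i)) : Summable f ∧ ∑' i, f i ≤ ∑' j, g j := by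
  have hf : Summable f := .of_nonneg_of_le hf0 hfg (hg.comp_injective he)
  exact ⟨hf, hf.tsum_le_tsum_of_inj e he (fun j _ => hg0 j) hfg hg⟩

/-- The central analytic estimate in the proof of the tightness lemma:
for `m > 1/2`, `k > 1/2` and `α > 0` there is a constant `C > 0` such that for
every `N ≥ 1`, the sum over `n ∈ ℤ` and over integers `z ≥ 1` not multiples of
`2N` of
`(n²+1)^{−m} z^{−2k} (N² sin²(πz/N) + N^{−α}) / (n² N^{−2α} + N⁴ sin⁴(πz/(2N)))`
is at most `C`. -/
theorem tightness_main_estimate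
    (m k α : ℝ) (hm : 1 / 2 < m) (hk : 1 / 2 < k) (hα : 0 < α) :
    ∃ C : ℝ, 0 < C ∧ ∀ N : ℕ, 1 ≤ N →
      Summable (fun p : ℤ × {z : ℕ // 1 ≤ z ∧ ¬ (2 * N ∣ z)} =>
        ((p.1 : ℝ) ^ 2 + 1) ^ (-m) * ((p.2 : ℕ) : ℝ) ^ (-(2 * k)) *
          (((N : ℝ) ^ 2 * Real.sin (Real.pi * (p.2 : ℕ) / N) ^ 2 + (N : ℝ) ^ (-α)) /
            ((p.1 : ℝ) ^ 2 * (N : ℝ) ^ (-(2 * α))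
              + (N : ℝ) ^ 4 * Real.sin (Real.pi * (p.2 : ℕ) / (2 * N)) ^ 4))) ∧
      (∑' p : ℤ × {z : ℕ // 1 ≤ z ∧ ¬ (2 * N ∣ z)},
        ((p.1 : ℝ) ^ 2 + 1) ^ (-m) * ((p.2 : ℕ) : ℝ) ^ (-(2 * k)) *
          (((N : ℝ) ^ 2 * Real.sin (Real.pi * (p.2 : ℕ) / N) ^ 2 + (N : ℝ) ^ (-α)) /
            ((p.1 : ℝ) ^ 2 * (N : ℝ) ^ (-(2 * α))
              + (N : ℝ) ^ 4 * Real.sin (Real.pi * (p.2 : ℕ) / (2 * N)) ^ 4))) ≤ C := by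
  have hweights : Summable fun p : ℤ × ℕ =>
      ((p.1 : ℝ) ^ 2 + 1) ^ (-m) * (p.2 : ℝ) ^ (-(2 * k)) * 5 :=
    ((summable_int_sq_add_one_rpow hm).mul_of_nonneg
      (Real.summable_nat_rpow.2 (by linarith)) (fun _ => by positivity)
      (fun _ => by positivity)).mul_right 5
  have htotal : 0 ≤ ∑' p : ℤ × ℕ, ((p.1 : ℝ) ^ 2 + 1) ^ (-m) * (p.2 : ℝ) ^ (-(2 * k)) * 5 :=
    tsum_nonneg fun _ => by positivity
  refine ⟨(∑' p : ℤ × ℕ, ((p.1 : ℝ) ^ 2 + 1) ^ (-m) * (p.2 : ℝ) ^ (-(2 * k)) * 5) + 1,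
    by positivity, fun N hN => ?_⟩
  have hinj : Function.Injective
      (Prod.map id Subtype.val : ℤ × {z : ℕ // 1 ≤ z ∧ ¬ (2 * N ∣ z)} → ℤ × ℕ) :=
    Function.injective_id.prodMap Subtype.val_injective
  refine (summable_and_tsum_le_of_injective hinj hweights (fun _ => by positivity)
    (fun _ => by positivity) fun p => ?_).imp_right fun h => h.trans (by linarith)
  exact mul_le_mul_of_nonneg_left (moment_quotient_le hα.le hN p.2.2.2 (p.1 : ℝ)) (by positivity)
end
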